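/- Let V be a finite set and E a finite set of unordered pairs {u,v} of distinct elements of V (a finite graph). Let J : E → ℝ satisfy J_e > 0 for all e ∈ E and let λ : V → ℝ satisfy λ_v ≥ 0 for all v ∈ V. For J > 0 let V_J(θ) = Σ_{m∈ℤ} exp(−(J/2)(θ + 2πm)²) (the periodized Gaussian, a finite positive function of θ ∈ ℝ). Define, for z ∈ ℂ, F(z) = ∫_{(−π,π]^V} exp( z Σ_{v∈V} λ_v cos θ_v ) ∏_{{u,v}∈E} V_{J_{{u,v}}}(θ_u − θ_v) ∏_{v∈V} dθ_v. Then F(z) ≠ 0 for every z ∈ ℂ with Re z ≠ 0. -/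

import Mathlib

open MeasureTheory Real

/-- The periodized Gaussian `V_J(θ) = ∑_{m ∈ ℤ} exp(-(J/2)(θ + 2πm)²)`. -/
noncomputable def villainWeight (J θ : ℝ) : ℝ :=
  ∑' m : ℤ, Real.exp (-(J / 2) * (θ + 2 * π * m) ^ 2)

lemma villainWeight_neg (J x : ℝ) : villainWeight J (-x) = villainWeight J x := by
  unfold villainWeight
  rw [← (Equiv.neg ℤ).tsum_eq (fun m : ℤ => Real.exp (-(J / 2) * (-x + 2 * π * m) ^ 2))]
  apply tsum_congr
  intro m
  show Real.exp (-(J / 2) * (-x + 2 * π * ((-m : ℤ) : ℝ)) ^ 2) = _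
  congr 1
  push_cast
  ring

/-- For a configuration of angles `θ : V → ℝ` and couplings `J`, the symmetric function
sending an unordered pair `{u, v}` to `V_{J(e)}(θ u - θ v)`. -/
noncomputable def villainEdge {V : Type*} (J : Sym2 V → ℝ) (θ : V → ℝ) (e : Sym2 V) : ℝ :=
  Sym2.lift ⟨fun u v => villainWeight (J e) (θ u - θ v), fun u v => by
    show villainWeight (J e) (θ u - θ v) = villainWeight (J e) (θ v - θ u)
    rw [← villainWeight_neg, neg_sub]⟩ e

open Filter Topology

/-- Joint convergence along `l ×ˢ 𝓝 z` is locally uniform convergence. -/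
lemma tendstoLocallyUniformlyOn_of_tendsto_prod {ι : Type*} {l : Filter ι} [l.NeBot] {U : Set ℂ}
    (hU : IsOpen U) {F : ι → ℂ → ℂ} {f : ℂ → ℂ}
    (h : ∀ z ∈ U, Tendsto (fun p : ι × ℂ => F p.1 p.2) (l ×ˢ 𝓝 z) (𝓝 (f z))) :
    TendstoLocallyUniformlyOn F f l U := by
  have hpt : ∀ z ∈ U, Tendsto (fun i => F i z) l (𝓝 (f z)) := fun z hz =>
    (h z hz).comp (tendsto_id.prodMk tendsto_const_nhds)
  have hcont : ∀ z ∈ U, ContinuousAt f z := by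
    intro z hz
    refine (closed_nhds_basis (f z)).tendsto_right_iff.2 fun W hW => ?_
    have h1 : ∀ᶠ p in 𝓝 z ×ˢ l, F p.2 p.1 ∈ W :=
      ((h z hz).comp tendsto_prod_swap).eventually hW.1
    filter_upwards [h1.curry, hU.mem_nhds hz] with y hy hyU
    exact hW.2.mem_of_tendsto (hpt y hyU) hy
  rw [hU.tendstoLocallyUniformlyOn_iff_forall_tendsto]
  intro z hz
  refine Tendsto.mono_right ?_ (nhds_le_uniformity (f z))
  exact (((hcont z hz).tendsto.comp tendsto_snd)).prodMk_nhds (h z hz)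

/-- **Hurwitz's theorem**: a locally uniform limit of zero-free holomorphic functions on a
preconnected open set is either zero-free or identically zero. -/
theorem TendstoLocallyUniformlyOn.ne_zero_of_ne_zero {ι : Type*} {l : Filter ι} [l.NeBot]
    {U : Set ℂ} (hU : IsOpen U) (hUc : IsPreconnected U) {F : ι → ℂ → ℂ} {f : ℂ → ℂ}
    (hlim : TendstoLocallyUniformlyOn F f l U)
    (hF : ∀ᶠ i in l, DifferentiableOn ℂ (F i) U)
    (hne : ∀ᶠ i in l, ∀ z ∈ U, F i z ≠ 0)
    {z₁ : ℂ} (h₁ : z₁ ∈ U) (hf : f z₁ ≠ 0) {z : ℂ} (hz : z ∈ U) : f z ≠ 0 := by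
  intro hfz
  have hdiff : DifferentiableOn ℂ f U := hlim.differentiableOn hF hU
  have hana : AnalyticOnNhd ℂ f U := hdiff.analyticOnNhd hU
  have hiso : ∀ᶠ w in 𝓝[≠] z, f w ≠ 0 := by
    rcases (hana z hz).eventually_eq_zero_or_eventually_ne_zero with h | h
    · exact absurd (hana.eqOn_zero_of_preconnected_of_eventuallyEq_zero hUc hz h h₁) hf
    · exact h
  obtain ⟨ε, hε, hεU⟩ := Metric.isOpen_iff.1 hU z hz
  obtain ⟨ε', hε', hne'⟩ := Metric.mem_nhdsWithin_iff.1 hiso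
  set r := min ε ε' / 2 with hr
  have hr0 : 0 < r := by positivity
  have hrε : r < ε := by
    have := min_le_left ε ε'; have := lt_min hε hε'; linarith
  have hrε' : r < ε' := by
    have := min_le_right ε ε'; have := lt_min hε hε'; linarith
  have hball : Metric.closedBall z r ⊆ U := (Metric.closedBall_subset_ball hrε).trans hεU
  have hsph : Metric.sphere z r ⊆ U := Metric.sphere_subset_closedBall.trans hball
  have hsne : (Metric.sphere z r).Nonempty := NormedSpace.sphere_nonempty.2 hr0.le
  obtain ⟨w₀, hw₀, hmin⟩ := (isCompact_sphere z r).exists_isMinOn hsne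
    ((hdiff.continuousOn.mono hsph).norm)
  set δ := ‖f w₀‖ with hδ
  have hδ0 : 0 < δ := by
    refine norm_pos_iff.2 (hne' ⟨?_, ?_⟩)
    · rw [Metric.mem_ball, Metric.mem_sphere.1 hw₀]; exact hrε'
    · rintro rfl
      simp at hw₀
      exact hr0.ne hw₀
  have hunif := (tendstoLocallyUniformlyOn_iff_forall_isCompact hU).1 hlim _ hball
    (isCompact_closedBall z r)
  rw [Metric.tendstoUniformlyOn_iff] at hunif
  obtain ⟨i, hi, hFi, hnei⟩ := ((hunif (δ / 2) (by positivity)).and (hF.and hne)).exists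
  have hcl : closure (Metric.ball z r) = Metric.closedBall z r := closure_ball z hr0.ne'
  have hinv : DiffContOnCl ℂ (fun w => (F i w)⁻¹) (Metric.ball z r) := by
    refine DifferentiableOn.diffContOnCl ?_
    rw [hcl]
    exact (hFi.mono hball).inv fun w hw => hnei w (hball hw)
  have hbound : ‖(F i z)⁻¹‖ ≤ (δ / 2)⁻¹ := by
    refine Complex.norm_le_of_forall_mem_frontier_norm_le Metric.isBounded_ball hinv ?_
      (subset_closure (Metric.mem_ball_self hr0))
    intro w hw
    rw [frontier_ball z hr0.ne'] at hw
    rw [norm_inv]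
    refine inv_anti₀ (by positivity) ?_
    have h1 := hi w (Metric.sphere_subset_closedBall hw)
    have h2 : δ ≤ ‖f w‖ := hmin hw
    rw [dist_eq_norm] at h1
    have h3 := norm_sub_norm_le (f w) (F i w)
    linarith
  have hzz := hi z (Metric.mem_closedBall_self hr0.le)
  rw [hfz, dist_zero_left] at hzz
  rw [norm_inv] at hbound
  have := (inv_le_inv₀ (norm_pos_iff.2 (hnei z hz)) (by positivity)).1 hbound
  linarith

/-- If `n i → ∞` and `n i * g i → t`, then `(1 + g i) ^ n i → exp t`. -/
lemma tendsto_one_add_pow_cexp {ι : Type*} {l : Filter ι} {n : ι → ℕ} {g : ι → ℂ} {t : ℂ}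
    (hn : Tendsto n l atTop) (h : Tendsto (fun i => (n i : ℂ) * g i) l (𝓝 t)) :
    Tendsto (fun i => (1 + g i) ^ n i) l (𝓝 (Complex.exp t)) := by
  have hn' : Tendsto (fun i => ((n i : ℂ))⁻¹) l (𝓝 0) :=
    (tendsto_inv_atTop_nhds_zero_nat (𝕜 := ℂ)).comp hn
  have hg : Tendsto g l (𝓝 0) := by
    have := hn'.mul h
    rw [zero_mul] at this
    refine this.congr' ?_
    filter_upwards [hn.eventually_ge_atTop 1] with i hi
    have : (n i : ℂ) ≠ 0 := by exact_mod_cast (by omega : n i ≠ 0)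
    field_simp
  have hd : HasDerivAt (fun x : ℂ => Complex.log (1 + x)) 1 0 := by
    have := ((hasDerivAt_id (0 : ℂ)).const_add 1).clog (by simp)
    simpa using this
  have hφ : ContinuousAt (dslope (fun x : ℂ => Complex.log (1 + x)) 0) 0 :=
    continuousAt_dslope_same.2 hd.differentiableAt
  have hlim := h.mul (hφ.tendsto.comp hg)
  rw [dslope_same, hd.deriv, mul_one] at hlim
  refine ((Complex.continuous_exp.tendsto t).comp hlim).congr' ?_
  filter_upwards [hg.eventually_ne (show (0 : ℂ) ≠ -1 by simp)] with i hi
  have h1 : 1 + g i ≠ 0 := fun h0 => hi (by linear_combination h0)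
  have h2 := sub_smul_dslope (fun x : ℂ => Complex.log (1 + x)) 0 (g i)
  simp only [sub_zero, smul_eq_mul, add_zero, Complex.log_one] at h2
  simp only [Function.comp_apply]
  rw [mul_assoc, h2, Complex.exp_nat_mul, Complex.exp_log h1]

/-- Hurwitz's theorem in the right half-plane for a jointly continuous one-parameter family. -/
lemma ne_zero_of_continuous_family {Φ : ℂ → ℂ → ℂ} (hcont : Continuous fun q : ℂ × ℂ => Φ q.1 q.2)
    (hdiff : ∀ ε, Differentiable ℂ (Φ ε))
    (hne : ∀ ε : ℝ, 0 < ε → ∀ w : ℂ, 0 < w.re → Φ ε w ≠ 0)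
    {w₁ : ℂ} (hw₁ : 0 < w₁.re) (h₁ : Φ 0 w₁ ≠ 0) {w : ℂ} (hw : 0 < w.re) : Φ 0 w ≠ 0 := by
  have hlim : TendstoLocallyUniformlyOn (fun (ε : ℝ) w => Φ ε w) (Φ 0) (𝓝[>] 0)
      {w : ℂ | 0 < w.re} := by
    refine tendstoLocallyUniformlyOn_of_tendsto_prod
      (isOpen_lt continuous_const Complex.continuous_re) fun z _ => ?_
    have h0 : Tendsto (fun ε : ℝ => (ε : ℂ)) (𝓝[>] 0) (𝓝 0) :=
      (Complex.continuous_ofReal.tendsto' 0 0 Complex.ofReal_zero).mono_left nhdsWithin_le_nhds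
    have h1 : Tendsto (fun q : ℝ × ℂ => ((q.1 : ℂ), q.2)) (𝓝[>] 0 ×ˢ 𝓝 z) (𝓝 (0, z)) :=
      (h0.comp tendsto_fst).prodMk_nhds tendsto_snd
    exact (hcont.tendsto (0, z)).comp h1
  exact hlim.ne_zero_of_ne_zero (isOpen_lt continuous_const Complex.continuous_re)
    (convex_halfSpace_re_gt 0).isPreconnected
    (Eventually.of_forall fun ε => (hdiff ε).differentiableOn)
    (eventually_mem_nhdsWithin.mono fun ε hε z hz => hne ε hε z hz) hw₁ h₁ hw

/-- A polynomial without zeros in the open right half-plane in all its variables. -/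
def MvPolynomial.IsHurwitzStable {σ : Type*} (p : MvPolynomial σ ℂ) : Prop :=
  ∀ y : σ → ℂ, (∀ i, 0 < (y i).re) → MvPolynomial.eval y p ≠ 0

namespace MvPolynomial

lemma IsHurwitzStable.mul {σ : Type*} {p q : MvPolynomial σ ℂ} (hp : p.IsHurwitzStable)
    (hq : q.IsHurwitzStable) : (p * q).IsHurwitzStable := fun y hy => by
  rw [map_mul]
  exact mul_ne_zero (hp y hy) (hq y hy)

lemma IsHurwitzStable.pow {σ : Type*} {p : MvPolynomial σ ℂ} (hp : p.IsHurwitzStable)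
    (n : ℕ) : (p ^ n).IsHurwitzStable := fun y hy => by
  rw [map_pow]
  exact pow_ne_zero _ (hp y hy)

lemma IsHurwitzStable.prod {σ ι : Type*} {s : Finset ι} {p : ι → MvPolynomial σ ℂ}
    (hp : ∀ i ∈ s, (p i).IsHurwitzStable) : (∏ i ∈ s, p i).IsHurwitzStable := fun y hy => by
  rw [map_prod]
  exact Finset.prod_ne_zero_iff.2 fun i hi => hp i hi y hy

end MvPolynomial

/-- The logarithmic derivative of a polynomial without zeros in the open right half-plane
has nonnegative real part there. -/
lemma Polynomial.re_derivative_div_nonneg {u : Polynomial ℂ}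
    (hu : ∀ x : ℂ, 0 < x.re → u.eval x ≠ 0) {x : ℂ} (hx : 0 < x.re) :
    0 ≤ (u.derivative.eval x / u.eval x).re := by
  rw [(IsAlgClosed.splits u).eval_derivative_div_eval_of_ne_zero (hu x hx)]
  have : ∀ s : Multiset ℂ, (∀ r ∈ s, r.re ≤ 0) →
      0 ≤ ((s.map fun r => 1 / (x - r)).sum).re := by
    intro s
    induction s using Multiset.induction_on with
    | empty => simp
    | cons a s ih =>
      intro h
      rw [Multiset.map_cons, Multiset.sum_cons, Complex.add_re]
      refine add_nonneg ?_ (ih fun r hr => h r (Multiset.mem_cons_of_mem hr))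
      have ha := h a (Multiset.mem_cons_self a s)
      rw [one_div, Complex.inv_re, Complex.sub_re]
      exact div_nonneg (by linarith) (Complex.normSq_nonneg _)
  refine this _ fun r hr => ?_
  by_contra! h
  exact hu r h (Polynomial.isRoot_of_mem_roots hr)

namespace MvPolynomial

/-- Restriction of a multivariate polynomial to a line parallel to a coordinate axis. -/
noncomputable def slice {σ : Type*} [DecidableEq σ] (y : σ → ℂ) (v : σ) :
    MvPolynomial σ ℂ →ₐ[ℂ] Polynomial ℂ :=
  aeval (Function.update (fun i => Polynomial.C (y i)) v Polynomial.X)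

lemma eval_slice {σ : Type*} [DecidableEq σ] (y : σ → ℂ) (v : σ) (p : MvPolynomial σ ℂ) (x : ℂ) :
    (slice y v p).eval x = eval (Function.update y v x) p := by
  induction p using MvPolynomial.induction_on with
  | C a => simp [slice]
  | add p q hp hq => simp [hp, hq]
  | mul_X p i hp =>
    rw [map_mul, Polynomial.eval_mul, hp, map_mul]
    congr 1
    by_cases h : i = v
    · subst h; simp [slice]
    · simp [slice, h]

lemma derivative_slice {σ : Type*} [DecidableEq σ] (y : σ → ℂ) (v : σ) (p : MvPolynomial σ ℂ) :
    (slice y v p).derivative = slice y v (pderiv v p) := by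
  induction p using MvPolynomial.induction_on with
  | C a => simp [slice]
  | add p q hp hq => simp [hp, hq]
  | mul_X p i hp =>
    rw [map_mul, Polynomial.derivative_mul, hp, pderiv_mul, map_add, map_mul, map_mul]
    have hX : (slice y v (X i)).derivative = slice y v (pderiv v (X i)) := by
      by_cases h : i = v
      · subst h; simp [slice]
      · simp [slice, h, pderiv_X_of_ne h]
    rw [hX]

/-- A Gauss--Lucas statement in several variables. -/
lemma IsHurwitzStable.X_mul_add_pderiv {σ : Type*} {p : MvPolynomial σ ℂ}
    (hp : p.IsHurwitzStable) (t v : σ) : (X t * p + pderiv v p).IsHurwitzStable := by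
  classical
  intro y hy h0
  have hu : ∀ x : ℂ, 0 < x.re → (slice y v p).eval x ≠ 0 := by
    intro x hx
    rw [eval_slice]
    refine hp _ fun i => ?_
    by_cases h : i = v
    · subst h; simpa using hx
    · simpa [h] using hy i
  have key := Polynomial.re_derivative_div_nonneg hu (hy v)
  have hpy := hp y hy
  rw [derivative_slice, eval_slice, eval_slice, Function.update_eq_self] at key
  rw [map_add, map_mul, eval_X] at h0
  have : eval y (pderiv v p) / eval y p = - y t := by
    rw [div_eq_iff hpy]; linear_combination h0
  rw [this, Complex.neg_re] at key
  linarith [hy t]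

section Extraction

variable {V : Type*}

/-- Specialise the parameters of a polynomial in the variables `V ⊕ Bool`: the variable
`inr true` becomes `w` and the auxiliary variable `inr false` becomes `0`. -/
noncomputable def specialize (w : ℂ) : MvPolynomial (V ⊕ Bool) ℂ →ₐ[ℂ] MvPolynomial V ℂ :=
  aeval (Sum.elim X fun b => if b then C w else 0)

@[simp] lemma specialize_X_inl (w : ℂ) (v : V) : specialize w (X (Sum.inl v)) = X v := by
  simp [specialize]

@[simp] lemma specialize_X_true (w : ℂ) :
    specialize w (X (Sum.inr true) : MvPolynomial (V ⊕ Bool) ℂ) = C w := by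
  simp [specialize]

@[simp] lemma specialize_X_false (w : ℂ) :
    specialize w (X (Sum.inr false) : MvPolynomial (V ⊕ Bool) ℂ) = 0 := by
  simp [specialize]

@[simp] lemma specialize_C (w a : ℂ) :
    specialize w (C a : MvPolynomial (V ⊕ Bool) ℂ) = C a := by
  simp [specialize]

lemma specialize_pderiv (w : ℂ) (v : V) (p : MvPolynomial (V ⊕ Bool) ℂ) :
    specialize w (pderiv (Sum.inl v) p) = pderiv v (specialize w p) := by
  classical
  induction p using MvPolynomial.induction_on with
  | C a => simp
  | add p q hp hq => simp [hp, hq]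
  | mul_X p i hp =>
    rw [pderiv_mul, map_add, map_mul, map_mul, hp, map_mul, pderiv_mul]
    have hX : specialize w (pderiv (Sum.inl v) (X i)) = pderiv v (specialize w (X i)) := by
      rcases i with i | i
      · by_cases h : i = v
        · subst h; simp
        · rw [pderiv_X_of_ne (by simpa using h), specialize_X_inl, pderiv_X_of_ne h, map_zero]
      · rw [pderiv_X_of_ne (by simp), map_zero]
        cases i <;> simp
    rw [hX]

lemma exists_stable_coeff_zero (s : Multiset V) [DecidableEq V] :
    ∀ p : MvPolynomial (V ⊕ Bool) ℂ, p.IsHurwitzStable →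
      ∃ G : MvPolynomial (V ⊕ Bool) ℂ, G.IsHurwitzStable ∧ ∃ c : ℂ, c ≠ 0 ∧
        ∀ w, coeff 0 (specialize w G) = c * coeff (Multiset.toFinsupp s) (specialize w p) := by
  induction s using Multiset.induction_on with
  | empty => exact fun p hp => ⟨p, hp, 1, one_ne_zero, by simp⟩
  | cons v s ih =>
    intro p hp
    obtain ⟨G, hG, c, hc, h⟩ := ih _ (hp.X_mul_add_pderiv (Sum.inr false) (Sum.inl v))
    refine ⟨G, hG, c * (Multiset.toFinsupp s v + 1), mul_ne_zero hc (by norm_cast), fun w => ?_⟩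
    rw [h w, map_add, map_mul, specialize_X_false, zero_mul, zero_add, specialize_pderiv,
      coeff_pderiv, ← Multiset.singleton_add, map_add,
      Multiset.toFinsupp_singleton, add_comm s.toFinsupp]
    ring

lemma eval_specialize_zero (w : ℂ) (p : MvPolynomial (V ⊕ Bool) ℂ) :
    coeff 0 (specialize w p) =
      eval (Sum.elim (fun _ => 0) fun b => if b then w else 0) p := by
  rw [← constantCoeff_eq]
  induction p using MvPolynomial.induction_on with
  | C a => simp
  | add p q hp hq => simp [hp, hq]
  | mul_X p i hp =>
    rw [map_mul, map_mul, hp, map_mul]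
    congr 1
    rcases i with i | (_ | _) <;> simp

lemma differentiable_eval {σ : Type*} (p : MvPolynomial σ ℂ) (y : ℂ → σ → ℂ)
    (hy : ∀ i, Differentiable ℂ fun w => y w i) : Differentiable ℂ fun w => eval (y w) p := by
  induction p using MvPolynomial.induction_on with
  | C a => simp
  | add p q hp hq =>
    simp only [map_add]
    exact hp.add hq
  | mul_X p i hp =>
    simp only [map_mul, eval_X]
    exact hp.mul (hy i)

lemma differentiable_coeff_specialize (k : V →₀ ℕ) {p : MvPolynomial (V ⊕ Bool) ℂ}
    (hp : p.IsHurwitzStable) : Differentiable ℂ fun w => coeff k (specialize w p) := by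
  classical
  obtain ⟨G, -, c, hc, h⟩ := exists_stable_coeff_zero (Finsupp.toMultiset k) p hp
  rw [Finsupp.toMultiset_toFinsupp] at h
  have : (fun w => coeff k (specialize w p)) =
      fun w => c⁻¹ * eval (Sum.elim (fun _ => 0) fun b => if b then w else 0) G := by
    funext w
    rw [← eval_specialize_zero, h w, inv_mul_cancel_left₀ hc]
  rw [this]
  refine (differentiable_eval G _ ?_).const_mul _
  rintro (i | (_ | _)) <;> simp

/-- Coefficients of a stable polynomial with a parameter `w` are, as functions of the
parameter, either zero-free in the right half-plane or identically zero there. -/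
theorem IsHurwitzStable.coeff_specialize_ne_zero {k : V →₀ ℕ} {p : MvPolynomial (V ⊕ Bool) ℂ}
    (hp : p.IsHurwitzStable) {w₁ : ℂ} (hw₁ : 0 < w₁.re)
    (h₁ : coeff k (specialize w₁ p) ≠ 0) {w : ℂ} (hw : 0 < w.re) :
    coeff k (specialize w p) ≠ 0 := by
  classical
  obtain ⟨G, hG, c, hc, h⟩ := exists_stable_coeff_zero (Finsupp.toMultiset k) p hp
  rw [Finsupp.toMultiset_toFinsupp] at h
  let y : ℂ → ℂ → V ⊕ Bool → ℂ := fun ε w =>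
    Sum.elim (fun _ => ε) fun b => if b then w else ε
  have hzero : ∀ w, eval (y 0 w) G = c * coeff k (specialize w p) := fun w => by
    rw [← h w, eval_specialize_zero]
  refine right_ne_zero_of_mul (a := c) ?_
  rw [← hzero]
  refine ne_zero_of_continuous_family (Φ := fun ε w => eval (y ε w) G) ?_ (fun ε => ?_) ?_ hw₁ ?_ hw
  · refine (continuous_eval G).comp (continuous_pi ?_)
    rintro (i | (_ | _))
    exacts [continuous_fst, continuous_fst, continuous_snd]
  · refine differentiable_eval G _ ?_
    rintro (i | (_ | _)) <;> simp [y]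
  · intro ε hε z hz
    refine hG _ ?_
    rintro (i | (_ | _))
    · simpa [y] using hε
    · simpa [y] using hε
    · simpa [y] using hz
  · rw [hzero]
    exact mul_ne_zero hc h₁

end Extraction

end MvPolynomial

section TripleProduct

/-- The reciprocal `1 / ((1 - Q) ⋯ (1 - Q ^ n))`, extended by zero to negative `n`. -/
noncomputable def invQPoch (Q : ℝ) : ℤ → ℝ
  | Int.ofNat n => ∏ j ∈ Finset.range n, (1 - Q ^ (j + 1))⁻¹
  | Int.negSucc _ => 0

variable {q Q : ℝ}

lemma invQPoch_sub_one (hQ0 : 0 < Q) (hQ1 : Q < 1) (k : ℤ) :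
    invQPoch Q (k - 1) = (1 - Q ^ k) * invQPoch Q k := by
  rcases k with (_ | n) | n
  · rw [show (Int.ofNat 0 - 1 : ℤ) = Int.negSucc 0 from rfl]
    simp [invQPoch]
  · have h : (Int.ofNat (n + 1) - 1 : ℤ) = Int.ofNat n := by simp
    have h2 : 1 - Q ^ (n + 1) ≠ 0 := by
      have := pow_lt_one₀ hQ0.le hQ1 (Nat.succ_ne_zero n); exact (sub_pos.2 this).ne'
    rw [h]
    simp only [invQPoch, Finset.prod_range_succ, Int.ofNat_eq_natCast, zpow_natCast]
    field_simp
  · have h : (Int.negSucc n - 1 : ℤ) = Int.negSucc (n + 1) := by omega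
    rw [h]; simp [invQPoch]

lemma invQPoch_nonneg (hQ0 : 0 < Q) (hQ1 : Q < 1) (k : ℤ) : 0 ≤ invQPoch Q k := by
  rcases k with n | n
  · refine Finset.prod_nonneg fun j _ => inv_nonneg.2 (sub_nonneg.2 ?_)
    exact pow_le_one₀ hQ0.le hQ1.le
  · exact le_rfl

lemma exists_tendsto_invQPoch (hQ0 : 0 < Q) (hQ1 : Q < 1) :
    ∃ L : ℝ, 0 < L ∧ Tendsto (invQPoch Q) atTop (𝓝 L) ∧ ∀ k, invQPoch Q k ≤ L := by
  have hmono : Monotone fun n : ℕ => invQPoch Q n := by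
    refine monotone_nat_of_le_succ fun n => ?_
    have := invQPoch_sub_one hQ0 hQ1 (n + 1)
    rw [add_sub_cancel_right] at this
    push_cast
    rw [this]
    refine mul_le_of_le_one_left (invQPoch_nonneg hQ0 hQ1 _) ?_
    linarith [zpow_pos hQ0 ((n : ℤ) + 1)]
  have hbdd : ∀ n : ℕ, invQPoch Q n ≤ Real.exp ((1 - Q)⁻¹ * (1 - Q)⁻¹) := by
    intro n
    calc invQPoch Q n = ∏ j ∈ Finset.range n, (1 - Q ^ (j + 1))⁻¹ := rfl
      _ ≤ ∏ j ∈ Finset.range n, Real.exp (Q ^ j * (1 - Q)⁻¹) := by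
        refine Finset.prod_le_prod (fun j _ => inv_nonneg.2 (sub_nonneg.2 ?_)) fun j _ => ?_
        · exact pow_le_one₀ hQ0.le hQ1.le
        · have h1 : 0 < 1 - Q := sub_pos.2 hQ1
          have h3 : Q ^ (j + 1) ≤ Q := pow_le_of_le_one hQ0.le hQ1.le (Nat.succ_ne_zero j)
          have h2 : 0 < 1 - Q ^ (j + 1) := by linarith
          have h4 : 0 < Q ^ j := pow_pos hQ0 j
          have h5 : Q ^ (j + 1) ≤ Q ^ j := by rw [pow_succ]; nlinarith
          refine le_trans ?_ (Real.add_one_le_exp _)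
          have : (1 - Q ^ (j + 1))⁻¹ = Q ^ (j + 1) * (1 - Q ^ (j + 1))⁻¹ + 1 := by
            field_simp; ring
          rw [this]
          gcongr
      _ = Real.exp ((∑ j ∈ Finset.range n, Q ^ j) * (1 - Q)⁻¹) := by
        rw [Finset.sum_mul, Real.exp_sum]
      _ ≤ _ := by
        have h1 : 0 < 1 - Q := sub_pos.2 hQ1
        gcongr
        rw [← tsum_geometric_of_lt_one hQ0.le hQ1]
        exact (summable_geometric_of_lt_one hQ0.le hQ1).sum_le_tsum _
          fun i _ => pow_nonneg hQ0.le i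
  have hBA : BddAbove (Set.range fun n : ℕ => invQPoch Q n) := ⟨_, by
    rintro _ ⟨n, rfl⟩; exact hbdd n⟩
  have hlim := tendsto_atTop_ciSup hmono hBA
  have hle : ∀ n : ℕ, invQPoch Q n ≤ ⨆ n : ℕ, invQPoch Q n := le_ciSup hBA
  have hpos : 0 < ⨆ n : ℕ, invQPoch Q n :=
    lt_of_lt_of_le (by simp [invQPoch]) (hle 0)
  refine ⟨_, hpos, ?_, ?_⟩
  · have : Tendsto (fun k : ℤ => invQPoch Q (k.toNat : ℤ)) atTop (𝓝 (⨆ n : ℕ, invQPoch Q n)) :=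
      hlim.comp (tendsto_atTop_atTop.2 fun b => ⟨b, fun a ha => by omega⟩)
    refine this.congr' ?_
    filter_upwards [eventually_ge_atTop 0] with k hk
    rw [Int.toNat_of_nonneg hk]
  · rintro (n | n)
    · exact hle n
    · exact hpos.le

/-- Finite form of the Jacobi triple product identity. -/
lemma hasSum_finite_triple_product (hq0 : 0 < q) (hq1 : q < 1) {x : ℂ} (hx : x ≠ 0) (N : ℕ) :
    HasSum (fun n : ℤ => ((q ^ (n ^ 2) * (invQPoch (q ^ 2) (N + n) * invQPoch (q ^ 2) (N - n)) :
        ℝ) : ℂ) * x ^ n)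
      ((invQPoch (q ^ 2) (2 * N) : ℝ) *
        ∏ m ∈ Finset.range N,
          (1 + (q : ℂ) ^ (2 * m + 1) * x) * (1 + (q : ℂ) ^ (2 * m + 1) * x⁻¹)) := by
  have hQ0 : 0 < q ^ 2 := by positivity
  have hQ1 : q ^ 2 < 1 := pow_lt_one₀ hq0.le hq1 two_ne_zero
  set r := invQPoch (q ^ 2) with hr
  have hrec : ∀ k, r (k - 1) = (1 - (q ^ 2) ^ k) * r k := invQPoch_sub_one hQ0 hQ1
  induction N with
  | zero =>
    have : ∀ n : ℤ, n ≠ 0 → r (0 + n) * r (0 - n) = 0 := by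
      rintro ((_ | n) | n) hn
      · simp at hn
      · have : (0 - Int.ofNat (n + 1) : ℤ) = Int.negSucc n := by
          simp [Int.negSucc_eq]
        rw [this]; simp [hr, invQPoch]
      · simp [hr, invQPoch]
    have h0 := hasSum_single (f := fun n : ℤ =>
      ((q ^ (n ^ 2) * (r ((0 : ℕ) + n) * r ((0 : ℕ) - n)) : ℝ) : ℂ) * x ^ n) 0 fun n hn => by
        simp only [Nat.cast_zero]
        rw [this n hn]; simp
    have hr0 : r 0 = 1 := by
      rw [hr, show (0 : ℤ) = Int.ofNat 0 from rfl]; simp [invQPoch]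
    simpa [hr0] using h0
  | succ N ih =>
    have hx1 := ((Equiv.subRight (1 : ℤ)).hasSum_iff (f := fun n : ℤ =>
      ((q ^ (n ^ 2) * (r (N + n) * r (N - n)) : ℝ) : ℂ) * x ^ n)).2 ih
    have hx2 := ((Equiv.addRight (1 : ℤ)).hasSum_iff (f := fun n : ℤ =>
      ((q ^ (n ^ 2) * (r (N + n) * r (N - n)) : ℝ) : ℂ) * x ^ n)).2 ih
    set A := (∏ m ∈ Finset.range N,
      (1 + (q : ℂ) ^ (2 * m + 1) * x) * (1 + (q : ℂ) ^ (2 * m + 1) * x⁻¹)) with hA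
    have hden : (1 - (q ^ 2) ^ (2 * (N : ℤ) + 1)) * (1 - (q ^ 2) ^ (2 * (N : ℤ) + 2)) ≠ 0 := by
      have h1 : ∀ k : ℕ, k ≠ 0 → 1 - (q ^ 2) ^ k ≠ 0 := fun k hk =>
        (sub_pos.2 (pow_lt_one₀ hQ0.le hQ1 hk)).ne'
      have a := h1 (2 * N + 1) (by omega)
      have b := h1 (2 * N + 2) (by omega)
      exact_mod_cast mul_ne_zero a b
    set d := (1 - (q ^ 2) ^ (2 * (N : ℤ) + 1)) * (1 - (q ^ 2) ^ (2 * (N : ℤ) + 2)) with hd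
    have hr2 : r (2 * N) = d * r (2 * ((N + 1 : ℕ) : ℤ)) := by
      have h1 := hrec (2 * N + 1)
      have h2 := hrec (2 * N + 2)
      rw [show (2 * (N : ℤ) + 1 - 1) = 2 * N by ring] at h1
      rw [show (2 * (N : ℤ) + 2 - 1) = 2 * N + 1 by ring] at h2
      rw [h1, h2, hd]
      push_cast
      rw [show 2 * ((N : ℤ) + 1) = 2 * N + 2 by ring]
      ring
    have hsum := (((ih.mul_left (1 + (q : ℂ) ^ (2 * (2 * N + 1)))).add
      ((hx1.mul_left ((q : ℂ) ^ (2 * N + 1) * x)))).add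
      (hx2.mul_left ((q : ℂ) ^ (2 * N + 1) * x⁻¹))).mul_left ((d⁻¹ : ℝ) : ℂ)
    convert! hsum using 1
    · funext n
      simp only [Function.comp_apply, Equiv.coe_addRight, Equiv.subRight_apply]
      have hxp : x * x ^ (n - 1) = x ^ n := by rw [← zpow_one_add₀ hx]; congr 1; ring
      have hxm : x⁻¹ * x ^ (n + 1) = x ^ n := by
        rw [zpow_add_one₀ hx]; field_simp
      have key : q ^ (n ^ 2) * (r (((N + 1 : ℕ) : ℤ) + n) * r (((N + 1 : ℕ) : ℤ) - n)) =
          d⁻¹ * ((1 + q ^ (2 * (2 * N + 1))) * (q ^ (n ^ 2) * (r (N + n) * r (N - n))) +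
            q ^ (2 * N + 1) * (q ^ ((n - 1) ^ 2) * (r (N + (n - 1)) * r (N - (n - 1)))) +
            q ^ (2 * N + 1) * (q ^ ((n + 1) ^ 2) * (r (N + (n + 1)) * r (N - (n + 1))))) := by
        rw [eq_inv_mul_iff_mul_eq₀ hden]
        push_cast
        set R := r ((N : ℤ) + 1 + n) with hR
        set S := r ((N : ℤ) + 1 - n) with hS
        set a := (q ^ 2) ^ ((N : ℤ) + 1 + n) with ha
        set b := (q ^ 2) ^ ((N : ℤ) + 1 - n) with hb
        have hq : q ≠ 0 := hq0.ne'
        have e1 : r (N + n) = (1 - a) * R := by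
          rw [ha, hR, ← hrec]; congr 1; ring
        have e2 : r (N - n) = (1 - b) * S := by
          rw [hb, hS, ← hrec]; congr 1; ring
        have e3 : r (N + (n - 1)) = (1 - a / q ^ 2) * ((1 - a) * R) := by
          have h := hrec (N + n)
          rw [e1, show (N : ℤ) + n - 1 = N + (n - 1) by ring] at h
          rw [h]
          congr 2
          rw [ha, show (N : ℤ) + 1 + n = (N + n) + 1 by ring, zpow_add_one₀ hQ0.ne']
          field_simp
        have e4 : r (N - (n + 1)) = (1 - b / q ^ 2) * ((1 - b) * S) := by
          have h := hrec (N - n)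
          rw [e2, show (N : ℤ) - n - 1 = N - (n + 1) by ring] at h
          rw [h]
          congr 2
          rw [hb, show (N : ℤ) + 1 - n = (N - n) + 1 by ring, zpow_add_one₀ hQ0.ne']
          field_simp
        have e5 : r (N - (n - 1)) = S := by rw [hS]; congr 1; ring
        have e6 : r (N + (n + 1)) = R := by rw [hR]; congr 1; ring
        have f0 : ∀ k : ℤ, (q ^ 2) ^ k = q ^ (2 * k) := fun k => by
          rw [zpow_mul]; norm_cast
        have f1 : q ^ (2 * N + 1) * q ^ ((n - 1) ^ 2) = q ^ (n ^ 2) * b := by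
          rw [hb, f0, ← zpow_natCast q (2 * N + 1), ← zpow_add₀ hq, ← zpow_add₀ hq]
          congr 1; push_cast; ring
        have f2 : q ^ (2 * N + 1) * q ^ ((n + 1) ^ 2) = q ^ (n ^ 2) * a := by
          rw [ha, f0, ← zpow_natCast q (2 * N + 1), ← zpow_add₀ hq, ← zpow_add₀ hq]
          congr 1; push_cast; ring
        have f3 : (q ^ 2) ^ (2 * (N : ℤ) + 2) = a * b := by
          rw [ha, hb, ← zpow_add₀ hQ0.ne']; congr 1; ring
        have f4 : (q ^ 2) ^ (2 * (N : ℤ) + 1) = a * b / q ^ 2 := by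
          rw [eq_div_iff hQ0.ne', ← f3, ← zpow_add_one₀ hQ0.ne']
          congr 1
        have f5 : q ^ (2 * (2 * N + 1)) = a * b / q ^ 2 := by
          rw [← f4, pow_mul]; norm_cast
        rw [hd, f3, f4, f5, e1, e2, e3, e4, e5, e6]
        rw [← mul_assoc (q ^ (2 * N + 1)) (q ^ ((n - 1) ^ 2)), f1,
          ← mul_assoc (q ^ (2 * N + 1)) (q ^ ((n + 1) ^ 2)), f2]
        field_simp
        ring
      rw [key]
      push_cast
      linear_combination (-(d : ℂ)⁻¹ * ((q : ℂ) ^ (2 * N + 1) *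
          ((q : ℂ) ^ ((n - 1) ^ 2) * (r (N + (n - 1)) * r (N - (n - 1)))))) * hxp -
        ((d : ℂ)⁻¹ * ((q : ℂ) ^ (2 * N + 1) *
          ((q : ℂ) ^ ((n + 1) ^ 2) * (r (N + (n + 1)) * r (N - (n + 1)))))) * hxm
    · rw [Finset.prod_range_succ, ← hA, hr2]
      have hd' : (d : ℂ) ≠ 0 := by exact_mod_cast hden
      push_cast
      field_simp
      ring

/-- The Jacobi triple product, as a limit up to a positive constant. -/
lemma exists_tendsto_triple_product (hq0 : 0 < q) (hq1 : q < 1) :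
    ∃ L : ℝ, 0 < L ∧ ∀ x : ℂ, ‖x‖ = 1 → Tendsto (fun N : ℕ => ∏ m ∈ Finset.range N,
        (1 + (q : ℂ) ^ (2 * m + 1) * x) * (1 + (q : ℂ) ^ (2 * m + 1) * x⁻¹)) atTop
      (𝓝 (L * ∑' n : ℤ, ((q ^ (n ^ 2) : ℝ) : ℂ) * x ^ n)) := by
  have hQ0 : 0 < q ^ 2 := by positivity
  have hQ1 : q ^ 2 < 1 := pow_lt_one₀ hq0.le hq1 two_ne_zero
  obtain ⟨L, hL, hlim, hle⟩ := exists_tendsto_invQPoch hQ0 hQ1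
  refine ⟨L, hL, fun x hx => ?_⟩
  have hx0 : x ≠ 0 := by rintro rfl; simp at hx
  set r := invQPoch (q ^ 2)
  have hcast : Tendsto (fun N : ℕ => (N : ℤ)) atTop atTop := tendsto_natCast_atTop_atTop
  have hsummable : Summable fun n : ℤ => q ^ (n ^ 2) := by
    have hnat : Summable fun n : ℕ => q ^ n := summable_geometric_of_lt_one hq0.le hq1
    have h2 : ∀ n : ℕ, q ^ (((n : ℤ)) ^ 2) ≤ q ^ n := fun n => by
      have : ((n : ℤ)) ^ 2 = ((n ^ 2 : ℕ) : ℤ) := by push_cast; ring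
      rw [this, zpow_natCast]
      exact pow_le_pow_of_le_one hq0.le hq1.le (Nat.le_self_pow two_ne_zero n)
    have h3 : Summable fun n : ℕ => q ^ (((n : ℤ)) ^ 2) :=
      hnat.of_nonneg_of_le (fun n => (zpow_pos hq0 _).le) h2
    exact Summable.of_nat_of_neg h3 (by simpa using h3)
  have htan : Tendsto (fun N : ℕ => ∑' n : ℤ, ((q ^ (n ^ 2) * (r (N + n) * r (N - n)) :
      ℝ) : ℂ) * x ^ n) atTop (𝓝 (∑' n : ℤ, ((q ^ (n ^ 2) * (L * L) : ℝ) : ℂ) * x ^ n)) := by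
    refine tendsto_tsum_of_dominated_convergence (bound := fun n : ℤ => q ^ (n ^ 2) * (L * L))
      (hsummable.mul_right _) (fun n => ?_) (Eventually.of_forall fun N n => ?_)
    · refine Tendsto.mul_const _ ((Complex.continuous_ofReal.tendsto _).comp ?_)
      refine Tendsto.const_mul _ (Tendsto.mul ?_ ?_)
      · exact hlim.comp (tendsto_atTop_add_const_right _ n hcast)
      · exact hlim.comp (tendsto_atTop_add_const_right _ (-n) hcast)
    · rw [norm_mul, norm_zpow, hx, one_zpow, mul_one, Complex.norm_real, Real.norm_eq_abs]
      have h1 := invQPoch_nonneg hQ0 hQ1 (N + n)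
      have h2 := invQPoch_nonneg hQ0 hQ1 (N - n)
      have h3 := zpow_pos hq0 (n ^ 2)
      rw [abs_of_nonneg (by positivity)]
      gcongr
      · exact hle _
      · exact hle _
  have hden : Tendsto (fun N : ℕ => ((r (2 * N) : ℝ) : ℂ)) atTop (𝓝 (L : ℂ)) := by
    have h2 : Tendsto (fun N : ℕ => 2 * (N : ℤ)) atTop atTop :=
      hcast.const_mul_atTop' (by norm_num)
    exact (Complex.continuous_ofReal.tendsto _).comp (hlim.comp h2)
  have hL' : (L : ℂ) ≠ 0 := by exact_mod_cast hL.ne'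
  have hquot := htan.div hden hL'
  have hval : (∑' n : ℤ, ((q ^ (n ^ 2) * (L * L) : ℝ) : ℂ) * x ^ n) / (L : ℂ) =
      L * ∑' n : ℤ, ((q ^ (n ^ 2) : ℝ) : ℂ) * x ^ n := by
    rw [div_eq_iff hL', ← tsum_mul_left, ← tsum_mul_right]
    refine tsum_congr fun n => ?_
    push_cast
    ring
  rw [hval] at hquot
  refine hquot.congr' ?_
  filter_upwards [hden.eventually_ne hL'] with N hN
  simp only [Pi.div_apply]
  rw [(hasSum_finite_triple_product hq0 hq1 hx0 N).tsum_eq, mul_div_cancel_left₀ _ hN]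

end TripleProduct

lemma summable_villainWeight {J : ℝ} (hJ : 0 < J) (θ : ℝ) :
    Summable fun m : ℤ => Real.exp (-(J / 2) * (θ + 2 * π * m) ^ 2) := by
  have hτ : 0 < (2 * π * J * Complex.I : ℂ).im := by
    rw [show (2 * π * J * Complex.I : ℂ) = ((2 * π * J : ℝ) : ℂ) * Complex.I by push_cast; ring,
      Complex.im_ofReal_mul, Complex.I_im, mul_one]
    positivity
  have h := ((summable_jacobiTheta₂_term_iff (Complex.I * J * θ) (2 * π * J * Complex.I)).2
    hτ).norm.mul_left (Real.exp (-(J / 2) * θ ^ 2))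
  refine h.congr fun m => ?_
  rw [jacobiTheta₂_term, Complex.norm_exp, ← Real.exp_add]
  congr 1
  have : 2 * (π : ℂ) * Complex.I * m * (Complex.I * J * θ) +
      π * Complex.I * (m : ℂ) ^ 2 * (2 * π * J * Complex.I) =
      ((-(2 * π * m * J * θ) - 2 * π ^ 2 * m ^ 2 * J : ℝ) : ℂ) := by
    push_cast
    linear_combination (2 * π * m * J * θ + 2 * π ^ 2 * m ^ 2 * J : ℂ) * Complex.I_sq
  rw [this, Complex.ofReal_re]
  ring

lemma villainWeight_pos {J : ℝ} (hJ : 0 < J) (θ : ℝ) : 0 < villainWeight J θ :=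
  (summable_villainWeight hJ θ).tsum_pos (fun _ => (Real.exp_pos _).le) 0 (Real.exp_pos _)

/-- The Fourier series of the Villain weight. -/
lemma tsum_fourier_villainWeight {J : ℝ} (hJ : 0 < J) (θ : ℝ) :
    ∑' n : ℤ, ((Real.exp (-(1 / (2 * J))) ^ (n ^ 2) : ℝ) : ℂ) * Complex.exp (θ * Complex.I) ^ n =
      ((√(2 * π * J) * villainWeight J θ : ℝ) : ℂ) := by
  have ha : 0 < ((1 / (2 * π * J) : ℝ) : ℂ).re := by
    rw [Complex.ofReal_re]; positivity
  have hJ' : (J : ℂ) ≠ 0 := by exact_mod_cast hJ.ne'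
  have hπ : (π : ℂ) ≠ 0 := by exact_mod_cast Real.pi_ne_zero
  have h := Complex.tsum_exp_neg_quadratic ha (Complex.I * θ / (2 * π))
  have hl : ∀ n : ℤ, Complex.exp (-π * ((1 / (2 * π * J) : ℝ) : ℂ) * n ^ 2 +
      2 * π * (Complex.I * θ / (2 * π)) * n) =
      ((Real.exp (-(1 / (2 * J))) ^ (n ^ 2) : ℝ) : ℂ) * Complex.exp (θ * Complex.I) ^ n := by
    intro n
    rw [Complex.ofReal_zpow, Complex.ofReal_exp, ← Complex.exp_int_mul, ← Complex.exp_int_mul,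
      ← Complex.exp_add]
    congr 1
    push_cast
    field_simp
  have hr : ∀ n : ℤ, Complex.exp (-π / ((1 / (2 * π * J) : ℝ) : ℂ) *
      (n + Complex.I * (Complex.I * θ / (2 * π))) ^ 2) =
      ((Real.exp (-(J / 2) * (-θ + 2 * π * n) ^ 2) : ℝ) : ℂ) := by
    intro n
    rw [Complex.ofReal_exp]
    congr 1
    rw [show Complex.I * (Complex.I * θ / (2 * π)) = -θ / (2 * π) by
      linear_combination (θ / (2 * π) : ℂ) * Complex.I_sq]
    push_cast
    field_simp
    ring
  simp_rw [hl, hr] at h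
  rw [h, ← Complex.ofReal_tsum, Complex.ofReal_mul]
  congr 1
  · rw [show (1 / 2 : ℂ) = ((1 / 2 : ℝ) : ℂ) by push_cast; rfl,
      ← Complex.ofReal_cpow (by positivity), ← Real.sqrt_eq_rpow, one_div (2 * π * J),
      Real.sqrt_inv]
    push_cast
    rw [one_div, inv_inv]
  · rw [← villainWeight_neg]; rfl

/-- The Villain weight is, up to a constant, a product of weights of cosine type. -/
theorem exists_tendsto_prod_villainWeight {J : ℝ} (hJ : 0 < J) :
    ∃ (q : ℕ → ℝ) (c : ℝ), (∀ m, 0 ≤ q m) ∧ Summable q ∧ 0 < c ∧ ∀ θ : ℝ,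
      Tendsto (fun N : ℕ => ∏ m ∈ Finset.range N, (1 + q m ^ 2 + 2 * q m * Real.cos θ)) atTop
        (𝓝 (c * villainWeight J θ)) := by
  set q := Real.exp (-(1 / (2 * J))) with hq
  have hq0 : 0 < q := Real.exp_pos _
  have hq1 : q < 1 := Real.exp_lt_one_iff.2 (by
    have : 0 < 1 / (2 * J) := by positivity
    linarith)
  obtain ⟨L, hL, hlim⟩ := exists_tendsto_triple_product hq0 hq1
  refine ⟨fun m => q ^ (2 * m + 1), L * √(2 * π * J), fun m => by positivity, ?_, by positivity,
    fun θ => ?_⟩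
  · refine (summable_geometric_of_lt_one hq0.le hq1).of_nonneg_of_le (fun m => by positivity)
      fun m => pow_le_pow_of_le_one hq0.le hq1.le (by omega)
  · have h := (Complex.continuous_re.tendsto _).comp
      (hlim (Complex.exp (θ * Complex.I)) (Complex.norm_exp_ofReal_mul_I θ))
    rw [tsum_fourier_villainWeight hJ, ← Complex.ofReal_mul, Complex.ofReal_re,
      ← mul_assoc] at h
    refine h.congr fun N => ?_
    have : ∏ m ∈ Finset.range N, (1 + (q : ℂ) ^ (2 * m + 1) * Complex.exp (θ * Complex.I)) *
        (1 + (q : ℂ) ^ (2 * m + 1) * (Complex.exp (θ * Complex.I))⁻¹) =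
        ((∏ m ∈ Finset.range N, (1 + (q ^ (2 * m + 1)) ^ 2 + 2 * q ^ (2 * m + 1) * Real.cos θ) :
          ℝ) : ℂ) := by
      rw [Complex.ofReal_prod]
      refine Finset.prod_congr rfl fun m _ => ?_
      push_cast
      rw [Complex.cos, neg_mul, ← Complex.exp_neg]
      have : Complex.exp (θ * Complex.I) * Complex.exp (-(θ * Complex.I)) = 1 := by
        rw [← Complex.exp_add, add_neg_cancel, Complex.exp_zero]
      linear_combination ((q : ℂ) ^ (2 * m + 1)) ^ 2 * this
    simp only [Function.comp_apply]
    rw [this, Complex.ofReal_re]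

section ConstantTerm

variable {V : Type*} [Fintype V]

/-- The torus `(-π, π]^V` with Lebesgue measure. -/
noncomputable abbrev torusMeasure (V : Type*) [Fintype V] : Measure (V → ℝ) :=
  Measure.pi fun _ : V => volume.restrict (Set.Ioc (-π) π)

lemma integral_circle_zpow (s : ℂ) (n : ℤ) :
    ∫ t in Set.Ioc (-π) π, (s * Complex.exp (t * Complex.I)) ^ n =
      if n = 0 then 2 * (π : ℂ) else 0 := by
  rw [← intervalIntegral.integral_of_le (by linarith [Real.pi_pos])]
  split_ifs with h
  · subst h
    simp; ring
  · have hc : (n : ℂ) * Complex.I ≠ 0 := mul_ne_zero (by exact_mod_cast h) Complex.I_ne_zero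
    have : ∀ t : ℝ, (s * Complex.exp (t * Complex.I)) ^ n =
        s ^ n * Complex.exp ((n * Complex.I) * t) := fun t => by
      rw [mul_zpow, ← Complex.exp_int_mul]
      congr 2; ring
    simp_rw [this]
    rw [intervalIntegral.integral_const_mul, integral_exp_mul_complex hc]
    have he : Complex.exp (n * Complex.I * (π : ℝ)) = Complex.exp (n * Complex.I * (-π : ℝ)) := by
      rw [Complex.exp_eq_exp_iff_exists_int]
      exact ⟨n, by push_cast; ring⟩
    rw [he]; simp

/-- Coefficients of a polynomial as Fourier integrals over a product of circles. -/
lemma integral_eval_div_eq_coeff [DecidableEq V] {s : ℂ} (hs : s ≠ 0)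
    (p : MvPolynomial V ℂ) (k : V →₀ ℕ) :
    ∫ θ : V → ℝ, MvPolynomial.eval (fun v => s * Complex.exp (θ v * Complex.I)) p /
        ∏ v, (s * Complex.exp (θ v * Complex.I)) ^ k v ∂(torusMeasure V) =
      (2 * π) ^ Fintype.card V * MvPolynomial.coeff k p := by
  have hne : ∀ t : ℝ, s * Complex.exp (t * Complex.I) ≠ 0 := fun t =>
    mul_ne_zero hs (Complex.exp_ne_zero _)
  have hexp : ∀ θ : V → ℝ, MvPolynomial.eval (fun v => s * Complex.exp (θ v * Complex.I)) p /
        ∏ v, (s * Complex.exp (θ v * Complex.I)) ^ k v =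
      ∑ m ∈ p.support, p.coeff m *
        ∏ v, (s * Complex.exp (θ v * Complex.I)) ^ ((m v : ℤ) - (k v : ℤ)) := by
    intro θ
    rw [MvPolynomial.eval_eq', Finset.sum_div]
    refine Finset.sum_congr rfl fun m _ => ?_
    rw [mul_div_assoc, ← Finset.prod_div_distrib]
    congr 1
    refine Finset.prod_congr rfl fun v _ => ?_
    rw [zpow_sub₀ (hne _), zpow_natCast, zpow_natCast]
  have hint : ∀ n : ℤ, Integrable (fun t : ℝ => (s * Complex.exp (t * Complex.I)) ^ n)
      (volume.restrict (Set.Ioc (-π) π)) := fun n => by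
    have : Continuous fun t : ℝ => (s * Complex.exp (t * Complex.I)) ^ n :=
      Continuous.zpow₀ (by fun_prop) n fun t => Or.inl (hne t)
    exact (this.integrableOn_Icc (a := -π) (b := π)).mono_set Set.Ioc_subset_Icc_self
  simp_rw [hexp]
  rw [integral_finsetSum _ fun m _ => (Integrable.fintype_prod
    (μ := fun _ : V => volume.restrict (Set.Ioc (-π) π))
    (f := fun v (t : ℝ) => (s * Complex.exp (t * Complex.I)) ^ ((m v : ℤ) - (k v : ℤ)))
    fun v => hint _).const_mul _]
  have hterm : ∀ m : V →₀ ℕ, ∫ θ : V → ℝ, p.coeff m *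
      ∏ v, (s * Complex.exp (θ v * Complex.I)) ^ ((m v : ℤ) - (k v : ℤ)) ∂(torusMeasure V) =
      if m = k then (2 * π) ^ Fintype.card V * p.coeff m else 0 := by
    intro m
    rw [integral_const_mul, integral_fintype_prod_eq_prod (𝕜 := ℂ)
      (μ := fun _ : V => volume.restrict (Set.Ioc (-π) π))
      (f := fun v (t : ℝ) => (s * Complex.exp (t * Complex.I)) ^ ((m v : ℤ) - (k v : ℤ)))]
    simp_rw [integral_circle_zpow]
    split_ifs with h
    · subst h
      simp [mul_comm]
    · obtain ⟨v, hv⟩ := Finsupp.ne_iff.1 h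
      rw [Finset.prod_eq_zero (Finset.mem_univ v), mul_zero]
      rw [if_neg]
      intro h0
      exact hv (by omega)
  simp_rw [hterm]
  rw [Finset.sum_ite_eq']
  split_ifs with h
  · rfl
  · rw [MvPolynomial.notMem_support_iff.1 h, mul_zero]

end ConstantTerm

section LeeYang

variable {V ι : Type*} [Fintype V]

/-- The polynomial whose Fourier coefficients are the partition functions of a finite graph with
edge weights `∏ m < N, (1 + q² + 2 q cos (θ_a - θ_b))` and vertex weights
`(1 + (w a)² + 2 w a cos θ) ^ N`, where `w` is the parameter. -/
noncomputable def leeYangPolynomial (E : Finset ι) (x y : ι → V) (q : ι → ℕ → ℝ) (a : V → ℝ)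
    (N : ℕ) : MvPolynomial (V ⊕ Bool) ℂ :=
  (∏ e ∈ E, ∏ m ∈ Finset.range N,
    (MvPolynomial.X (Sum.inl (x e)) +
        MvPolynomial.C (q e m : ℂ) * MvPolynomial.X (Sum.inl (y e))) *
      (MvPolynomial.X (Sum.inl (y e)) +
        MvPolynomial.C (q e m : ℂ) * MvPolynomial.X (Sum.inl (x e)))) *
  ∏ v, ((1 + MvPolynomial.C (a v : ℂ) * MvPolynomial.X (Sum.inr true) *
        MvPolynomial.X (Sum.inl v)) *
      (MvPolynomial.X (Sum.inl v) +
        MvPolynomial.C (a v : ℂ) * MvPolynomial.X (Sum.inr true))) ^ N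

lemma add_ofReal_mul_ne_zero {x y : ℂ} {q : ℝ} (hq : 0 ≤ q) (hx : 0 < x.re) (hy : 0 < y.re) :
    x + q * y ≠ 0 := by
  intro h
  have := congrArg Complex.re h
  rw [Complex.add_re, Complex.re_ofReal_mul, Complex.zero_re] at this
  nlinarith [mul_nonneg hq hy.le]

lemma one_add_ofReal_mul_mul_ne_zero {x y : ℂ} {q : ℝ} (hq : 0 ≤ q) (hx : 0 < x.re)
    (hy : 0 < y.re) : 1 + q * x * y ≠ 0 := by
  have hy0 : y ≠ 0 := by
    rintro rfl
    simp at hy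
  have hinv : 0 < (y⁻¹).re := by
    rw [Complex.inv_re]
    exact div_pos hy (Complex.normSq_pos.2 hy0)
  intro h
  refine add_ofReal_mul_ne_zero hq hinv hx ?_
  field_simp
  linear_combination h

lemma isHurwitzStable_leeYangPolynomial {E : Finset ι} {x y : ι → V} {q : ι → ℕ → ℝ} {a : V → ℝ}
    (hq : ∀ e ∈ E, ∀ m, 0 ≤ q e m) (ha : ∀ v, 0 ≤ a v) (N : ℕ) :
    (leeYangPolynomial E x y q a N).IsHurwitzStable := by
  refine .mul (.prod fun e he => .prod fun m _ => .mul ?_ ?_) (.prod fun v _ => .pow (.mul ?_ ?_) _)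
  · intro t ht
    simpa using add_ofReal_mul_ne_zero (hq e he m) (ht _) (ht _)
  · intro t ht
    simpa using add_ofReal_mul_ne_zero (hq e he m) (ht _) (ht _)
  · intro t ht
    simpa using one_add_ofReal_mul_mul_ne_zero (ha v) (ht _) (ht _)
  · intro t ht
    simpa using add_ofReal_mul_ne_zero (ha v) (ht _) (ht _)

/-- The approximate Gibbs factor: a product of edge and vertex weights of cosine type. -/
noncomputable def cosineWeight (E : Finset ι) (x y : ι → V) (q : ι → ℕ → ℝ) (a : V → ℝ) (s : ℝ)
    (N : ℕ) (w : ℂ) (θ : V → ℝ) : ℂ :=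
  ((∏ e ∈ E, ∏ m ∈ Finset.range N,
      (1 + q e m ^ 2 + 2 * q e m * Real.cos (θ (x e) - θ (y e))) : ℝ) : ℂ) *
    ∏ v, (1 + ((w * a v) ^ 2 + 2 * (w * a v) * (s * Real.cos (θ v) : ℝ))) ^ N

lemma edge_factor_eq (s q α β : ℝ) :
    ((s * Complex.exp (α * Complex.I) + q * (s * Complex.exp (β * Complex.I))) *
      (s * Complex.exp (β * Complex.I) + q * (s * Complex.exp (α * Complex.I))) : ℂ) =
    ((1 + q ^ 2 + 2 * q * Real.cos (α - β) : ℝ) : ℂ) *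
      (s * Complex.exp (α * Complex.I) * (s * Complex.exp (β * Complex.I))) := by
  have hA : Complex.exp (α * Complex.I) * Complex.exp (-(α * Complex.I)) = 1 := by
    rw [← Complex.exp_add, add_neg_cancel, Complex.exp_zero]
  have hB : Complex.exp (β * Complex.I) * Complex.exp (-(β * Complex.I)) = 1 := by
    rw [← Complex.exp_add, add_neg_cancel, Complex.exp_zero]
  push_cast
  rw [Complex.cos, show ((α : ℂ) - β) * Complex.I = α * Complex.I + -(β * Complex.I) by ring,
    show -((α : ℂ) - β) * Complex.I = -(α * Complex.I) + β * Complex.I by ring,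
    Complex.exp_add, Complex.exp_add]
  linear_combination (-(q : ℂ) * s ^ 2 * Complex.exp (β * Complex.I) ^ 2) * hA -
    (q * s ^ 2 * Complex.exp (α * Complex.I) ^ 2) * hB

lemma vertex_factor_eq {s : ℝ} (hs : s ^ 2 = 1) (u : ℂ) (α : ℝ) :
    (1 + u * (s * Complex.exp (α * Complex.I))) * (s * Complex.exp (α * Complex.I) + u) =
      (1 + (u ^ 2 + 2 * u * (s * Real.cos α : ℝ))) * (s * Complex.exp (α * Complex.I)) := by
  have hA : Complex.exp (α * Complex.I) * Complex.exp (-(α * Complex.I)) = 1 := by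
    rw [← Complex.exp_add, add_neg_cancel, Complex.exp_zero]
  have hs' : (s : ℂ) ^ 2 = 1 := by exact_mod_cast hs
  push_cast
  rw [Complex.cos, neg_mul]
  linear_combination (-u * s ^ 2) * hA - u * hs'

/-- The integral of the approximate Gibbs factor is a coefficient of a stable polynomial. -/
lemma exists_integral_cosineWeight_eq_coeff [DecidableEq V] (E : Finset ι) (x y : ι → V)
    (q : ι → ℕ → ℝ) (a : V → ℝ) {s : ℝ} (hs : s ^ 2 = 1) (N : ℕ) :
    ∃ k : V →₀ ℕ, ∀ w : ℂ, ∫ θ, cosineWeight E x y q a s N w θ ∂(torusMeasure V) =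
      (2 * π) ^ Fintype.card V *
        MvPolynomial.coeff k (MvPolynomial.specialize w (leeYangPolynomial E x y q a N)) := by
  have hs0 : (s : ℂ) ≠ 0 := by
    have : s ≠ 0 := by rintro rfl; norm_num at hs
    exact_mod_cast this
  refine ⟨Finsupp.equivFunOnFinite.symm fun v =>
    ∑ e ∈ E, ((if v = x e then N else 0) + if v = y e then N else 0) + N, fun w => ?_⟩
  rw [← integral_eval_div_eq_coeff hs0]
  refine integral_congr_ae (Eventually.of_forall fun θ => ?_)
  have hne : ∀ v, (s : ℂ) * Complex.exp (θ v * Complex.I) ≠ 0 := fun v =>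
    mul_ne_zero hs0 (Complex.exp_ne_zero _)
  have hmon : ∀ X : V → ℂ, ∏ v, X v ^
      (∑ e ∈ E, ((if v = x e then N else 0) + if v = y e then N else 0) + N) =
      (∏ e ∈ E, ∏ _m ∈ Finset.range N, X (x e) * X (y e)) * ∏ v, X v ^ N := by
    intro X
    simp_rw [pow_add, Finset.prod_mul_distrib, ← Finset.prod_pow_eq_pow_sum]
    rw [Finset.prod_comm]
    congr 1
    rw [← Finset.prod_mul_distrib]
    refine Finset.prod_congr rfl fun e _ => ?_
    simp only [pow_add, pow_ite, pow_zero, Finset.prod_mul_distrib, Finset.prod_ite_eq',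
      Finset.mem_univ, if_true, Finset.prod_const, Finset.card_range]
  dsimp only
  rw [eq_div_iff (Finset.prod_ne_zero_iff.2 fun v _ => pow_ne_zero _ (hne v))]
  simp only [Finsupp.equivFunOnFinite_symm_apply_apply]
  rw [hmon fun v => s * Complex.exp (θ v * Complex.I), cosineWeight, mul_mul_mul_comm,
    Complex.ofReal_prod, ← Finset.prod_mul_distrib, ← Finset.prod_mul_distrib,
    leeYangPolynomial]
  simp only [map_mul, map_prod, map_pow, map_add, map_one, MvPolynomial.specialize_X_inl,
    MvPolynomial.specialize_X_true, MvPolynomial.algHom_C, MvPolynomial.algebraMap_eq,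
    MvPolynomial.eval_X, MvPolynomial.eval_C]
  congr 1
  · refine Finset.prod_congr rfl fun e _ => ?_
    rw [Complex.ofReal_prod, ← Finset.prod_mul_distrib]
    exact Finset.prod_congr rfl fun m _ => (edge_factor_eq _ _ _ _).symm
  · refine Finset.prod_congr rfl fun v _ => ?_
    rw [← mul_pow, ← vertex_factor_eq hs, mul_comm w]

lemma cos_factor_nonneg (q t : ℝ) : 0 ≤ 1 + q ^ 2 + 2 * q * Real.cos t := by
  nlinarith [Real.sin_sq_add_cos_sq t, sq_nonneg (q + Real.cos t), sq_nonneg (Real.sin t)]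

lemma prod_cos_factor_le {q : ℕ → ℝ} (hq : ∀ m, 0 ≤ q m) (hsum : Summable q) (N : ℕ) (t : ℝ) :
    ∏ m ∈ Finset.range N, (1 + q m ^ 2 + 2 * q m * Real.cos t) ≤ Real.exp (2 * ∑' m, q m) := by
  calc ∏ m ∈ Finset.range N, (1 + q m ^ 2 + 2 * q m * Real.cos t)
      ≤ ∏ m ∈ Finset.range N, Real.exp (2 * q m) := by
        refine Finset.prod_le_prod (fun m _ => cos_factor_nonneg _ _) fun m _ => ?_
        have h1 : 1 + q m ≤ Real.exp (q m) := by linarith [Real.add_one_le_exp (q m)]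
        rw [two_mul, Real.exp_add]
        nlinarith [hq m, mul_le_mul_of_nonneg_left (Real.cos_le_one t) (hq m)]
    _ = Real.exp (2 * ∑ m ∈ Finset.range N, q m) := by rw [← Real.exp_sum, Finset.mul_sum]
    _ ≤ _ := by
        gcongr
        exact hsum.sum_le_tsum _ fun m _ => hq m

lemma norm_vertex_factor_pow_le {s : ℝ} (hs : s ^ 2 = 1) {l : ℝ} (hl : 0 ≤ l) (w : ℂ) (N : ℕ)
    (t : ℝ) :
    ‖(1 + ((w * (l / (2 * N) : ℝ)) ^ 2 + 2 * (w * (l / (2 * N) : ℝ)) *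
      (s * Real.cos t : ℝ))) ^ N‖ ≤ Real.exp (‖w‖ * l) := by
  set u : ℂ := w * (l / (2 * N) : ℝ) with hu
  have hu' : ‖u‖ = ‖w‖ * (l / (2 * N)) := by
    rw [hu, norm_mul, Complex.norm_real, Real.norm_of_nonneg (by positivity)]
  clear_value u
  have hc : ‖((s * Real.cos t : ℝ) : ℂ)‖ ≤ 1 := by
    rw [Complex.norm_real, Real.norm_eq_abs, abs_mul,
      sq_eq_sq_iff_abs_eq_abs s 1 |>.1 (by rw [hs, one_pow]), abs_one, one_mul]
    exact Real.abs_cos_le_one t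
  have h1 : ‖1 + (u ^ 2 + 2 * u * (s * Real.cos t : ℝ))‖ ≤ Real.exp (2 * ‖u‖) := by
    calc ‖1 + (u ^ 2 + 2 * u * (s * Real.cos t : ℝ))‖
        ≤ 1 + (‖u‖ ^ 2 + 2 * ‖u‖ * 1) := by
          refine (norm_add_le _ _).trans ?_
          rw [norm_one]
          gcongr
          refine (norm_add_le _ _).trans ?_
          rw [norm_pow, norm_mul, norm_mul, Complex.norm_ofNat]
          gcongr
      _ = (1 + ‖u‖) ^ 2 := by ring
      _ ≤ Real.exp ‖u‖ ^ 2 := by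
          gcongr
          linarith [Real.add_one_le_exp ‖u‖]
      _ = _ := by rw [← Real.exp_nat_mul]; norm_num
  rw [norm_pow]
  refine (pow_le_pow_left₀ (norm_nonneg _) h1 N).trans ?_
  rw [← Real.exp_nat_mul, Real.exp_le_exp, hu']
  rcases N.eq_zero_or_pos with rfl | hN
  · simp; positivity
  · have : (N : ℝ) ≠ 0 := by positivity
    refine le_of_eq ?_
    field_simp

lemma tendsto_vertex_factor_pow (l s t : ℝ) (w : ℂ) :
    Tendsto (fun p : ℕ × ℂ => (1 + ((p.2 * (l / (2 * p.1) : ℝ)) ^ 2 +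
      2 * (p.2 * (l / (2 * p.1) : ℝ)) * (s * Real.cos t : ℝ))) ^ p.1) (atTop ×ˢ 𝓝 w)
      (𝓝 (Complex.exp (w * s * (l * Real.cos t : ℝ)))) := by
  refine tendsto_one_add_pow_cexp tendsto_fst ?_
  have hinv : Tendsto (fun p : ℕ × ℂ => ((p.1 : ℂ))⁻¹) (atTop ×ˢ 𝓝 w) (𝓝 0) :=
    (tendsto_inv_atTop_nhds_zero_nat (𝕜 := ℂ)).comp tendsto_fst
  have h2 : Tendsto (fun p : ℕ × ℂ => p.2) (atTop ×ˢ 𝓝 w) (𝓝 w) := tendsto_snd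
  have := (((h2.pow 2).mul_const ((l : ℂ) ^ 2 / 4)).mul hinv).add
    (h2.mul_const ((s : ℂ) * (l * Real.cos t : ℝ)))
  rw [mul_zero, zero_add, ← mul_assoc] at this
  refine this.congr' ?_
  filter_upwards [tendsto_fst.eventually_ge_atTop (1 : ℕ)] with p hp
  have : (p.1 : ℂ) ≠ 0 := by exact_mod_cast (by omega : p.1 ≠ 0)
  push_cast
  field_simp
  ring

lemma tendsto_integral_cosineWeight {E : Finset ι} {x y : ι → V} {q : ι → ℕ → ℝ}
    (hq : ∀ e ∈ E, ∀ m, 0 ≤ q e m) (hsum : ∀ e ∈ E, Summable (q e)) {W : ι → ℝ → ℝ}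
    (hW : ∀ e ∈ E, ∀ t, Tendsto (fun N : ℕ => ∏ m ∈ Finset.range N,
      (1 + q e m ^ 2 + 2 * q e m * Real.cos t)) atTop (𝓝 (W e t)))
    {l : V → ℝ} (hl : ∀ v, 0 ≤ l v) {s : ℝ} (hs : s ^ 2 = 1) (w : ℂ) :
    Tendsto (fun p : ℕ × ℂ => ∫ θ, cosineWeight E x y q (fun v => l v / (2 * p.1)) s p.1 p.2 θ
        ∂(torusMeasure V)) (atTop ×ˢ 𝓝 w)
      (𝓝 (∫ θ, Complex.exp (w * s * ((∑ v, l v * Real.cos (θ v) : ℝ) : ℂ)) *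
        ((∏ e ∈ E, W e (θ (x e) - θ (y e)) : ℝ) : ℂ) ∂(torusMeasure V))) := by
  refine tendsto_integral_filter_of_dominated_convergence
    (fun _ => (∏ e ∈ E, Real.exp (2 * ∑' m, q e m)) * ∏ v, Real.exp ((‖w‖ + 1) * l v))
    (Eventually.of_forall fun p => ?_) ?_ (integrable_const _)
    (Eventually.of_forall fun θ => ?_)
  · refine Continuous.aestronglyMeasurable ?_
    unfold cosineWeight
    fun_prop
  · have hR : ∀ᶠ p : ℕ × ℂ in atTop ×ˢ 𝓝 w, ‖p.2‖ < ‖w‖ + 1 :=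
      (tendsto_snd.norm).eventually (gt_mem_nhds (lt_add_one _))
    filter_upwards [hR] with p hp
    refine Eventually.of_forall fun θ => ?_
    rw [cosineWeight, norm_mul, Complex.norm_real, norm_prod, norm_prod]
    gcongr with e he v hv
    · rw [Real.norm_of_nonneg (Finset.prod_nonneg fun m _ => cos_factor_nonneg _ _)]
      exact prod_cos_factor_le (hq e he) (hsum e he) _ _
    · refine (norm_vertex_factor_pow_le hs (hl v) _ _ _).trans ?_
      gcongr
      exact hl v
  · have h1 : Tendsto (fun p : ℕ × ℂ => ((∏ e ∈ E, ∏ m ∈ Finset.range p.1,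
        (1 + q e m ^ 2 + 2 * q e m * Real.cos (θ (x e) - θ (y e))) : ℝ) : ℂ)) (atTop ×ˢ 𝓝 w)
        (𝓝 ((∏ e ∈ E, W e (θ (x e) - θ (y e)) : ℝ) : ℂ)) :=
      (Complex.continuous_ofReal.tendsto _).comp
        (tendsto_finsetProd _ fun e he => (hW e he _).comp tendsto_fst)
    have h2 : Tendsto (fun p : ℕ × ℂ => ∏ v, (1 + ((p.2 * (l v / (2 * p.1) : ℝ)) ^ 2 +
        2 * (p.2 * (l v / (2 * p.1) : ℝ)) * (s * Real.cos (θ v) : ℝ))) ^ p.1) (atTop ×ˢ 𝓝 w)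
        (𝓝 (∏ v, Complex.exp (w * s * (l v * Real.cos (θ v) : ℝ)))) :=
      tendsto_finsetProd _ fun v _ => tendsto_vertex_factor_pow _ _ _ _
    rw [← Complex.exp_sum, ← Finset.mul_sum, ← Complex.ofReal_sum] at h2
    rw [mul_comm (Complex.exp _)]
    exact h1.mul h2

/-- Positivity of the partition function at real parameter. -/
lemma integral_exp_mul_prod_ne_zero {E : Finset ι} {x y : ι → V} {W : ι → ℝ → ℝ}
    (hWm : ∀ e ∈ E, Measurable (W e)) (hWpos : ∀ e ∈ E, ∀ t, 0 < W e t)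
    {B : ι → ℝ} (hWB : ∀ e ∈ E, ∀ t, W e t ≤ B e) (l : V → ℝ) (r : ℝ) :
    ∫ θ, Complex.exp (r * ((∑ v, l v * Real.cos (θ v) : ℝ) : ℂ)) *
        ((∏ e ∈ E, W e (θ (x e) - θ (y e)) : ℝ) : ℂ) ∂(torusMeasure V) ≠ 0 := by
  have hpos : ∀ θ : V → ℝ, 0 < Real.exp (r * ∑ v, l v * Real.cos (θ v)) *
      ∏ e ∈ E, W e (θ (x e) - θ (y e)) := fun θ =>
    mul_pos (Real.exp_pos _) (Finset.prod_pos fun e he => hWpos e he _)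
  have hint : Integrable (fun θ : V → ℝ => Real.exp (r * ∑ v, l v * Real.cos (θ v)) *
      ∏ e ∈ E, W e (θ (x e) - θ (y e))) (torusMeasure V) := by
    refine Integrable.of_bound (C := Real.exp (|r| * ∑ v, |l v|) * ∏ e ∈ E, B e) ?_
      (Eventually.of_forall fun θ => ?_)
    · refine (Measurable.mul (by fun_prop) ?_).aestronglyMeasurable
      exact Finset.measurable_prod _ fun e he => (hWm e he).comp (by fun_prop)
    · rw [Real.norm_of_nonneg (hpos θ).le]
      refine mul_le_mul (Real.exp_le_exp.2 ?_) (Finset.prod_le_prod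
        (fun e he => (hWpos e he _).le) fun e he => hWB e he _)
        (Finset.prod_nonneg fun e he => (hWpos e he _).le) (Real.exp_pos _).le
      refine (le_abs_self _).trans ?_
      rw [abs_mul]
      gcongr
      refine (Finset.abs_sum_le_sum_abs _ _).trans (Finset.sum_le_sum fun v _ => ?_)
      rw [abs_mul]
      exact mul_le_of_le_one_right (abs_nonneg _) (Real.abs_cos_le_one _)
  have huniv : 0 < torusMeasure V Set.univ := by
    rw [Measure.pi_univ]
    simp [Real.pi_pos, pos_iff_ne_zero]
  have hI := (integral_pos_iff_support_of_nonneg (fun θ => (hpos θ).le) hint).2 (by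
    rwa [Function.support_eq_univ fun θ => (hpos θ).ne'])
  have : ∀ θ : V → ℝ, Complex.exp (r * ((∑ v, l v * Real.cos (θ v) : ℝ) : ℂ)) *
        ((∏ e ∈ E, W e (θ (x e) - θ (y e)) : ℝ) : ℂ) =
      ((Real.exp (r * ∑ v, l v * Real.cos (θ v)) * ∏ e ∈ E, W e (θ (x e) - θ (y e)) : ℝ) : ℂ) := by
    intro θ
    push_cast
    rfl
  simp_rw [this]
  rw [integral_complex_ofReal]
  exact_mod_cast hI.ne'

/-- **Lee–Yang theorem** for ferromagnetic plane rotators whose edge weights are infinite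
products of cosine factors. -/
theorem lee_yang_of_tendsto_prod [DecidableEq V] {E : Finset ι} {x y : ι → V} {q : ι → ℕ → ℝ}
    (hq : ∀ e ∈ E, ∀ m, 0 ≤ q e m) (hsum : ∀ e ∈ E, Summable (q e)) {W : ι → ℝ → ℝ}
    (hW : ∀ e ∈ E, ∀ t, Tendsto (fun N : ℕ => ∏ m ∈ Finset.range N,
      (1 + q e m ^ 2 + 2 * q e m * Real.cos t)) atTop (𝓝 (W e t)))
    (hWpos : ∀ e ∈ E, ∀ t, 0 < W e t) {l : V → ℝ} (hl : ∀ v, 0 ≤ l v) {z : ℂ} (hz : z.re ≠ 0) :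
    ∫ θ, Complex.exp (z * ((∑ v, l v * Real.cos (θ v) : ℝ) : ℂ)) *
        ((∏ e ∈ E, W e (θ (x e) - θ (y e)) : ℝ) : ℂ) ∂(torusMeasure V) ≠ 0 := by
  obtain ⟨s, hs, hzs⟩ : ∃ s : ℝ, s ^ 2 = 1 ∧ 0 < (z * s).re := by
    rcases hz.lt_or_gt with h | h
    · exact ⟨-1, by norm_num, by simpa using h⟩
    · exact ⟨1, by norm_num, by simpa using h⟩
  have hWm : ∀ e ∈ E, Measurable (W e) := fun e he =>
    measurable_of_tendsto_metrizable (fun N => by fun_prop) (tendsto_pi_nhds.2 (hW e he))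
  have hWB : ∀ e ∈ E, ∀ t, W e t ≤ Real.exp (2 * ∑' m, q e m) := fun e he t =>
    le_of_tendsto' (hW e he t) fun N => prod_cos_factor_le (hq e he) (hsum e he) N t
  set H : ℂ → ℂ := fun w => ∫ θ, Complex.exp (w * s * ((∑ v, l v * Real.cos (θ v) : ℝ) : ℂ)) *
    ((∏ e ∈ E, W e (θ (x e) - θ (y e)) : ℝ) : ℂ) ∂(torusMeasure V) with hH
  have hH1 : H 1 ≠ 0 := by
    have := integral_exp_mul_prod_ne_zero (x := x) (y := y) hWm hWpos hWB l s
    simpa only [hH, one_mul] using this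
  have hconv := fun w : ℂ => tendsto_integral_cosineWeight (x := x) (y := y) hq hsum hW hl hs w
  have hU : IsOpen {w : ℂ | 0 < w.re} := isOpen_lt continuous_const Complex.continuous_re
  have hlim := tendstoLocallyUniformlyOn_of_tendsto_prod hU (f := H)
    (F := fun (N : ℕ) w => ∫ θ, cosineWeight E x y q (fun v => l v / (2 * N)) s N w θ
      ∂(torusMeasure V)) fun w _ => hconv w
  have hstable := fun N : ℕ => isHurwitzStable_leeYangPolynomial (x := x) (y := y) hq
    (fun v => div_nonneg (hl v) (by positivity : (0 : ℝ) ≤ 2 * N)) N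
  have hmain := hlim.ne_zero_of_ne_zero hU (convex_halfSpace_re_gt 0).isPreconnected
    (Eventually.of_forall fun N => ?_) ?_ (z₁ := 1) (by simp) hH1 (show z * s ∈ _ from hzs)
  · simp only [hH] at hmain
    have hs' : (s : ℂ) * s = 1 := by exact_mod_cast (sq s ▸ hs)
    rwa [mul_assoc, hs', mul_one] at hmain
  · obtain ⟨k, hk⟩ := exists_integral_cosineWeight_eq_coeff E x y q (fun v => l v / (2 * N)) hs N
    simp_rw [hk]
    exact ((MvPolynomial.differentiable_coeff_specialize k (hstable N)).const_mul
      _).differentiableOn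
  · have h1 := ((hconv 1).comp (tendsto_id.prodMk tendsto_const_nhds)).eventually_ne hH1
    filter_upwards [h1] with N hN w hw
    obtain ⟨k, hk⟩ := exists_integral_cosineWeight_eq_coeff E x y q (fun v => l v / (2 * N)) hs N
    simp only [Function.comp_apply, id] at hN
    rw [hk] at hN ⊢
    have h2 := right_ne_zero_of_mul hN
    exact mul_ne_zero (left_ne_zero_of_mul hN)
      ((hstable N).coeff_specialize_ne_zero (by simp) h2 hw)

end LeeYang

/-- Lee–Yang theorem for the Villain model: on a finite graph `(V, E)` with couplings
`J_e > 0` and nonnegative weights `λ_v ≥ 0`, the (unnormalized) moment generating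
function of `∑_v λ_v cos θ_v` has only pure imaginary zeros. -/
theorem villain_model_lee_yang {V : Type*} [Fintype V] [DecidableEq V]
    (E : Finset (Sym2 V)) (hE : ∀ e ∈ E, ¬ e.IsDiag)
    (J : Sym2 V → ℝ) (hJ : ∀ e ∈ E, 0 < J e)
    (lam : V → ℝ) (hlam : ∀ v, 0 ≤ lam v)
    (z : ℂ) (hz : z.re ≠ 0) :
    (∫ θ : V → ℝ,
        Complex.exp (z * ((∑ v, lam v * Real.cos (θ v) : ℝ) : ℂ)) *
          ((∏ e ∈ E, villainEdge J θ e : ℝ) : ℂ)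
        ∂(Measure.pi fun _ : V => volume.restrict (Set.Ioc (-π) π))) ≠ 0 := by
  have hex : ∀ e ∈ E, ∃ (q : ℕ → ℝ) (c : ℝ), (∀ m, 0 ≤ q m) ∧ Summable q ∧ 0 < c ∧ ∀ t : ℝ,
      Tendsto (fun N : ℕ => ∏ m ∈ Finset.range N, (1 + q m ^ 2 + 2 * q m * Real.cos t)) atTop
        (𝓝 (c * villainWeight (J e) t)) := fun e he => exists_tendsto_prod_villainWeight (hJ e he)
  choose! q c hq hsum hc hlim using hex
  have hmain := lee_yang_of_tendsto_prod (x := fun e : Sym2 V => (Quot.out e).1)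
    (y := fun e => (Quot.out e).2) hq hsum hlim
    (fun e he t => mul_pos (hc e he) (villainWeight_pos (hJ e he) t)) hlam hz
  have hedge : ∀ (θ : V → ℝ) (e : Sym2 V),
      villainEdge J θ e = villainWeight (J e) (θ (Quot.out e).1 - θ (Quot.out e).2) := by
    intro θ e
    have h : s((Quot.out e).1, (Quot.out e).2) = e := Quot.out_eq e
    conv_lhs => rw [← h]
    rw [villainEdge, Sym2.lift_mk, h]
  intro h0
  apply hmain
  simp_rw [Finset.prod_mul_distrib, ← hedge, Complex.ofReal_mul, mul_left_comm (Complex.exp _)]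
  rw [integral_const_mul]
  exact mul_eq_zero_of_right _ h0
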